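/- Let α > 2 and β > 1. Then ∫₀^∞ β^{2/α} max(β, y)^{-2/α} / (1 + y) dy = ln(1 + β) + ∑_{k=0}^∞ (-1/β)^k / (k + 2/α), the series on the right converging absolutely. (The series equals (α/2) · ₂F₁(1, 2/α; 1 + 2/α; -1/β), the value of the Gauss hypergeometric function appearing in the average-rate constant 𝒜.) -/

import Mathlib

open MeasureTheory Real Set

/-- The average-rate constant: for `α > 2` and `β > 1`,
`∫₀^∞ β^{2/α} max(β, y)^{-2/α} / (1 + y) dy = ln(1 + β) + ∑_{k=0}^∞ (-1/β)^k / (k + 2/α)`,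
the series converging absolutely (its sum is `(α/2) ₂F₁(1, 2/α; 1 + 2/α; -1/β)`). -/
theorem rate_constant_integral
    (α β : ℝ) (hα : 2 < α) (hβ : 1 < β) :
    (Summable fun k : ℕ => |(-1 / β) ^ k / ((k : ℝ) + 2 / α)|) ∧
      ∫ y in Ioi (0 : ℝ), β ^ (2 / α) * max β y ^ (-(2 / α)) / (1 + y) =
        Real.log (1 + β) + ∑' k : ℕ, (-1 / β) ^ k / ((k : ℝ) + 2 / α) := by
  have hs : 0 < 2 / α := by positivity
  generalize 2 / α = s at hs
  have hβ0 : 0 < β := by linarith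
  have hβs : 0 < β ^ s := rpow_pos_of_pos hβ0 s
  have habs : ∀ k : ℕ, |(-1 / β) ^ k / ((k : ℝ) + s)| = (1 / β) ^ k / ((k : ℝ) + s) := by
    intro k
    have hk : (0 : ℝ) < k + s := by positivity
    rw [abs_div, abs_pow, abs_div, abs_neg, abs_one, abs_of_pos hβ0, abs_of_pos hk]
  have hsum : Summable fun k : ℕ => |(-1 / β) ^ k / ((k : ℝ) + s)| := by
    have hg : Summable fun k : ℕ => (1 / β) ^ k / s :=
      (summable_geometric_of_lt_one (by positivity)
        (by rw [div_lt_one hβ0]; exact hβ)).div_const s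
    refine Summable.of_nonneg_of_le (fun k => abs_nonneg _) (fun k => ?_) hg
    rw [habs]
    have : s ≤ (k : ℝ) + s := by
      have : (0 : ℝ) ≤ k := by positivity
      linarith
    gcongr
  refine ⟨hsum, ?_⟩
  have hI : ∀ k : ℕ, ∫ y in Ioi β, β ^ s * y ^ (-s - k - 1) = (1 / β) ^ k / ((k : ℝ) + s) := by
    intro k
    have hk : (0 : ℝ) ≤ k := by positivity
    have hk' : (0 : ℝ) < k + s := by positivity
    rw [integral_const_mul, integral_Ioi_rpow_of_lt (by linarith) hβ0]
    have e : -s - (k : ℝ) - 1 + 1 = -(k + s) := by ring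
    rw [e, rpow_neg hβ0.le, rpow_add hβ0, rpow_natCast, div_pow, one_pow]
    field_simp
  have hInt : ∀ k : ℕ, IntegrableOn (fun y : ℝ => β ^ s * y ^ (-s - k - 1)) (Ioi β) := by
    intro k
    have hk : (0 : ℝ) ≤ k := by positivity
    exact (integrableOn_Ioi_rpow_of_lt (by linarith) hβ0).const_mul _
  let F : ℕ → ℝ → ℝ := fun k y => (-1) ^ k * (β ^ s * y ^ (-s - k - 1))
  have hF : ∀ k, Integrable (F k) (volume.restrict (Ioi β)) := fun k => (hInt k).const_mul _
  have hFI : ∀ k, ∫ y in Ioi β, F k y = (-1 / β) ^ k / ((k : ℝ) + s) := by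
    intro k
    simp only [F]
    rw [integral_const_mul, hI]
    rw [← mul_div_assoc, ← mul_pow]
    congr 2
    ring
  have hFN : ∀ k, ∫ y in Ioi β, ‖F k y‖ = |(-1 / β) ^ k / ((k : ℝ) + s)| := by
    intro k
    rw [habs, ← hI]
    refine setIntegral_congr_fun measurableSet_Ioi (fun y hy => ?_)
    have hy0 : 0 < y := hβ0.trans hy
    have : 0 < y ^ (-s - k - 1) := rpow_pos_of_pos hy0 _
    simp only [F, norm_mul, norm_pow, norm_neg, norm_one, one_pow, one_mul, Real.norm_eq_abs]
    rw [abs_of_pos hβs, abs_of_pos this]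
  have hHS := hasSum_integral_of_summable_integral_norm hF (by simpa only [hFN] using hsum)
  simp only [hFI] at hHS
  have hpt : ∀ y ∈ Ioi β, ∑' k, F k y = β ^ s * max β y ^ (-s) / (1 + y) := by
    intro y hy
    have hy' : β < y := hy
    have hy0 : 0 < y := hβ0.trans hy
    have h1y : 1 < y := hβ.trans hy
    have e : ∀ k, F k y = (β ^ s * y ^ (-s) / y) * (-1 / y) ^ k := by
      intro k
      simp only [F]
      rw [rpow_sub_one hy0.ne', rpow_sub hy0, rpow_natCast, div_pow]
      ring
    simp only [e]
    rw [tsum_mul_left, tsum_geometric_of_abs_lt_one, max_eq_right hy'.le]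
    · have : 1 + y ≠ 0 := by positivity
      have h2 : 1 - -1 / y = (1 + y) / y := by field_simp; ring
      rw [h2]
      field_simp
    · rw [abs_div, abs_neg, abs_one, abs_of_pos hy0, div_lt_one hy0]; exact h1y
  rw [setIntegral_congr_fun measurableSet_Ioi hpt] at hHS
  have hA : EqOn (fun y => (1 + y)⁻¹) (fun y => β ^ s * max β y ^ (-s) / (1 + y)) (Ioc 0 β) := by
    intro y hy
    simp only
    rw [max_eq_left hy.2, rpow_neg hβ0.le, mul_inv_cancel₀ hβs.ne', one_div]
  have hd : ∀ y ∈ uIcc 0 β, HasDerivAt (fun y => Real.log (1 + y)) ((1 + y)⁻¹) y := by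
    intro y hy
    rw [uIcc_of_le hβ0.le] at hy
    have : 1 + y ≠ 0 := by linarith [hy.1]
    simpa using ((hasDerivAt_id y).const_add 1).log this
  have hii : IntervalIntegrable (fun y : ℝ => (1 + y)⁻¹) volume 0 β := by
    apply ContinuousOn.intervalIntegrable
    intro y hy
    rw [uIcc_of_le hβ0.le] at hy
    have : 1 + y ≠ 0 := by linarith [hy.1]
    exact ContinuousAt.continuousWithinAt (by fun_prop (disch := assumption))
  have hAint : IntegrableOn (fun y => β ^ s * max β y ^ (-s) / (1 + y)) (Ioc 0 β) :=
    ((intervalIntegrable_iff_integrableOn_Ioc_of_le hβ0.le).1 hii).congr_fun hA measurableSet_Ioc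
  have hAval : ∫ y in Ioc 0 β, β ^ s * max β y ^ (-s) / (1 + y) = Real.log (1 + β) := by
    rw [← setIntegral_congr_fun measurableSet_Ioc hA, ← intervalIntegral.integral_of_le hβ0.le,
      intervalIntegral.integral_eq_sub_of_hasDerivAt hd hii]
    simp
  have hBint : IntegrableOn (fun y => β ^ s * max β y ^ (-s) / (1 + y)) (Ioi β) := by
    refine Integrable.mono' (hInt 0) (Measurable.aestronglyMeasurable (by fun_prop)) ?_
    refine (ae_restrict_iff' measurableSet_Ioi).2 (Filter.Eventually.of_forall fun y hy => ?_)
    have hy' : β < y := hy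
    have hy0 : 0 < y := hβ0.trans hy
    have : 0 < y ^ (-s) := rpow_pos_of_pos hy0 _
    rw [max_eq_right hy'.le, Real.norm_eq_abs, abs_of_pos (by positivity), Nat.cast_zero, sub_zero,
      rpow_sub_one hy0.ne', ← mul_div_assoc]
    gcongr
    linarith
  rw [← Ioc_union_Ioi_eq_Ioi hβ0.le, setIntegral_union Ioc_disjoint_Ioi_same measurableSet_Ioi
    hAint hBint, hAval, hHS.tsum_eq]
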